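/- arXiv:2408.05181 — 2 statements merged into one kernel-verified Lean document; each statement's English description precedes it below -/
import Mathlib

section
/- Let H and A be weak bialgebras such that A is a left H-module algebra. Then the subspace A♯H = (A#H)(1_A#1_H) of A#H is closed under the smash product, with (x♯h)(y♯g) = x(h₁·y)♯(h₂g) for all x,y ∈ A, h,g ∈ H, and the element 1_A♯1_H is a two-sided unit for A♯H; hence A♯H is a unital associative algebra. -/
open TensorProduct

noncomputable section

namespace WeakSmash

variable (k : Type*) [Field k]

/-- A weak bialgebra structure on the `k`-algebra `H`. -/
structure WeakBialgebra (H : Type*) [Ring H] [Algebra k H] where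
  comul : H →ₗ[k] H ⊗[k] H
  counit : H →ₗ[k] k
  coassoc : ∀ h : H,
    (TensorProduct.assoc k H H H) ((LinearMap.rTensor H comul) (comul h)) =
      (LinearMap.lTensor H comul) (comul h)
  counit_comul : ∀ h : H,
    (TensorProduct.lid k H) ((LinearMap.rTensor H counit) (comul h)) = h
  comul_counit : ∀ h : H,
    (TensorProduct.rid k H) ((LinearMap.lTensor H counit) (comul h)) = h
  comul_mul : ∀ h g : H, comul (h * g) = comul h * comul g
  counit_weak : ∀ h g l : H,
    counit (h * g * l) =
      LinearMap.mul' k k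
        ((TensorProduct.map (counit ∘ₗ LinearMap.mulLeft k h)
            (counit ∘ₗ LinearMap.mulRight k l)) (comul g))
  counit_weak' : ∀ h g l : H,
    counit (h * g * l) =
      LinearMap.mul' k k
        ((TensorProduct.map (counit ∘ₗ LinearMap.mulLeft k h)
            (counit ∘ₗ LinearMap.mulRight k l)) ((TensorProduct.comm k H H) (comul g)))
  comul_one_left :
    ((TensorProduct.assoc k H H H) (comul 1 ⊗ₜ[k] (1 : H))) * ((1 : H) ⊗ₜ[k] comul 1) =
      (LinearMap.lTensor H comul) (comul 1)
  comul_one_right :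
    ((1 : H) ⊗ₜ[k] comul 1) * ((TensorProduct.assoc k H H H) (comul 1 ⊗ₜ[k] (1 : H))) =
      (LinearMap.lTensor H comul) (comul 1)

variable {k}

namespace WeakBialgebra

variable {H : Type*} [Ring H] [Algebra k H]

/-- The target counital map `εt h = ε(1₁ h) 1₂`. -/
def εt (W : WeakBialgebra k H) : H →ₗ[k] H :=
  (TensorProduct.lid k H).toLinearMap ∘ₗ LinearMap.rTensor H W.counit ∘ₗ
    LinearMap.mulLeft k (W.comul 1) ∘ₗ (TensorProduct.mk k H H).flip 1

/-- The source counital map `εs h = 1₁ ε(h 1₂)`. -/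
def εs (W : WeakBialgebra k H) : H →ₗ[k] H :=
  (TensorProduct.rid k H).toLinearMap ∘ₗ LinearMap.lTensor H W.counit ∘ₗ
    LinearMap.mulRight k (W.comul 1) ∘ₗ TensorProduct.mk k H H 1

/-- Cocommutativity of a weak bialgebra. -/
def Cocomm (W : WeakBialgebra k H) : Prop :=
  ∀ h : H, (TensorProduct.comm k H H) (W.comul h) = W.comul h

/-- `S` is an antipode for `W`, making it a weak Hopf algebra. -/
structure IsAntipode (W : WeakBialgebra k H) (S : H →ₗ[k] H) : Prop where
  mul_antipode : ∀ h : H,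
    LinearMap.mul' k H ((LinearMap.lTensor H S) (W.comul h)) = W.εt h
  antipode_mul : ∀ h : H,
    LinearMap.mul' k H ((LinearMap.rTensor H S) (W.comul h)) = W.εs h
  antipode_mid : ∀ h : H,
    LinearMap.mul' k H
      ((TensorProduct.map S (LinearMap.mul' k H ∘ₗ LinearMap.lTensor H S))
        ((LinearMap.lTensor H W.comul) (W.comul h))) = S h

/-- `α` is a left integral: `h α = εt(h) α`. -/
def IsLeftIntegral (W : WeakBialgebra k H) (α : H) : Prop :=
  ∀ h : H, h * α = W.εt h * α

end WeakBialgebra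

section MatchedPair

variable (k)
variable {H A : Type*} [Ring H] [Algebra k H] [Ring A] [Algebra k A]

/-- `A` is a left `H`-module algebra via the action `act`. -/
structure IsModuleAlgebra (WH : WeakBialgebra k H) (act : H →ₗ[k] A →ₗ[k] A) : Prop where
  one_act : ∀ a : A, act 1 a = a
  act_mul : ∀ (h : H) (a b : A),
    act h (a * b) =
      LinearMap.mul' k A ((TensorProduct.map (act.flip a) (act.flip b)) (WH.comul h))
  act_act : ∀ (h g : H) (a : A), act h (act g a) = act (h * g) a
  act_unit : ∀ h : H, act h 1 = act (WH.εt h) 1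

/-- The map `h ↦ ε(h⁰) h¹`. -/
def coactCounit (WH : WeakBialgebra k H) (coact : H →ₗ[k] H ⊗[k] A) : H →ₗ[k] A :=
  (TensorProduct.lid k A).toLinearMap ∘ₗ LinearMap.rTensor A WH.counit ∘ₗ coact

/-- `H` is a right `A`-comodule coalgebra via the coaction `coact`. -/
structure IsComoduleCoalgebra (WH : WeakBialgebra k H) (WA : WeakBialgebra k A)
    (coact : H →ₗ[k] H ⊗[k] A) : Prop where
  counit_coact : ∀ h : H,
    (TensorProduct.rid k H) ((LinearMap.lTensor H WA.counit) (coact h)) = h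
  comul_coact : ∀ h : H,
    (LinearMap.rTensor A WH.comul) (coact h) =
      (LinearMap.lTensor (H ⊗[k] H) (LinearMap.mul' k A))
        ((TensorProduct.tensorTensorTensorComm k H A H A)
          ((TensorProduct.map coact coact) (WH.comul h)))
  coact_coact : ∀ h : H,
    (TensorProduct.assoc k H A A) ((LinearMap.rTensor A coact) (coact h)) =
      (LinearMap.lTensor H WA.comul) (coact h)
  coact_counit : ∀ h : H,
    coactCounit k WH coact h = WA.εs (coactCounit k WH coact h)

/-- The map `(h₁ ⊗ h₂) ⊗ (x₁ ⊗ x₂) ↦ (h₁⁰ · x₁) ⊗ (h₁¹ (h₂ · x₂))`. -/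
def pairMapA (act : H →ₗ[k] A →ₗ[k] A) (coact : H →ₗ[k] H ⊗[k] A) :
    (H ⊗[k] H) ⊗[k] (A ⊗[k] A) →ₗ[k] A ⊗[k] A :=
  LinearMap.lTensor A (LinearMap.mul' k A) ∘ₗ
  (TensorProduct.assoc k A A A).toLinearMap ∘ₗ
  LinearMap.rTensor A
    (LinearMap.rTensor A (TensorProduct.lift act) ∘ₗ
      (TensorProduct.assoc k H A A).symm.toLinearMap ∘ₗ
      LinearMap.lTensor H (TensorProduct.comm k A A).toLinearMap ∘ₗ
      (TensorProduct.assoc k H A A).toLinearMap) ∘ₗ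
  TensorProduct.map (LinearMap.rTensor A coact) (TensorProduct.lift act) ∘ₗ
  (TensorProduct.tensorTensorTensorComm k H H A A).toLinearMap

/-- The map `(h₁ ⊗ h₂) ⊗ (g⁰ ⊗ g¹) ↦ (h₁⁰ g⁰) ⊗ (h₁¹ (h₂ · g¹))`. -/
def pairMapH (act : H →ₗ[k] A →ₗ[k] A) (coact : H →ₗ[k] H ⊗[k] A) :
    (H ⊗[k] H) ⊗[k] (H ⊗[k] A) →ₗ[k] H ⊗[k] A :=
  LinearMap.lTensor H (LinearMap.mul' k A) ∘ₗ
  (TensorProduct.assoc k H A A).toLinearMap ∘ₗ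
  LinearMap.rTensor A
    (LinearMap.rTensor A (LinearMap.mul' k H) ∘ₗ
      (TensorProduct.assoc k H H A).symm.toLinearMap ∘ₗ
      LinearMap.lTensor H (TensorProduct.comm k A H).toLinearMap ∘ₗ
      (TensorProduct.assoc k H A H).toLinearMap) ∘ₗ
  TensorProduct.map (LinearMap.rTensor H coact) (TensorProduct.lift act) ∘ₗ
  (TensorProduct.tensorTensorTensorComm k H H H A).toLinearMap

/-- The iterated comultiplication `h ↦ h₁ ⊗ (h₂ ⊗ h₃)`. -/
def twoComul (WH : WeakBialgebra k H) : H →ₗ[k] H ⊗[k] (H ⊗[k] H) :=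
  LinearMap.lTensor H WH.comul ∘ₗ WH.comul

/-- The iterated comultiplication `h ↦ h₁ ⊗ (h₂ ⊗ (h₃ ⊗ h₄))`. -/
def threeComul (WH : WeakBialgebra k H) : H →ₗ[k] H ⊗[k] (H ⊗[k] (H ⊗[k] H)) :=
  LinearMap.lTensor H (LinearMap.lTensor H WH.comul) ∘ₗ LinearMap.lTensor H WH.comul ∘ₗ WH.comul

/-- Left-hand side of the matched pair condition (iii):
`(h₁·x)₁ ⊗ (h₂ g)⁰ ⊗ (h₁·x)₂ (h₂ g)¹`. -/
def mpLHS (WH : WeakBialgebra k H) (WA : WeakBialgebra k A)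
    (act : H →ₗ[k] A →ₗ[k] A) (coact : H →ₗ[k] H ⊗[k] A) (h g : H) (x : A) :
    (A ⊗[k] H) ⊗[k] A :=
  LinearMap.lTensor (A ⊗[k] H) (LinearMap.mul' k A)
    ((TensorProduct.tensorTensorTensorComm k A A H A)
      ((TensorProduct.map (WA.comul ∘ₗ act.flip x) (coact ∘ₗ LinearMap.mulRight k g))
        (WH.comul h)))

/-- Right-hand side of the matched pair condition (iii):
`(h₁⁰ · x₁) ⊗ (h₃⁰ g⁰) ⊗ (h₁¹ (h₂ · x₂) h₃¹ (h₄ · g¹))`. -/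
def mpRHS (WH : WeakBialgebra k H) (WA : WeakBialgebra k A)
    (act : H →ₗ[k] A →ₗ[k] A) (coact : H →ₗ[k] H ⊗[k] A) (h g : H) (x : A) :
    (A ⊗[k] H) ⊗[k] A :=
  LinearMap.lTensor (A ⊗[k] H) (LinearMap.mul' k A)
    ((TensorProduct.tensorTensorTensorComm k A A H A)
      ((TensorProduct.map
          (pairMapA k act coact ∘ₗ
            (TensorProduct.mk k (H ⊗[k] H) (A ⊗[k] A)).flip (WA.comul x))
          (pairMapH k act coact ∘ₗ
            (TensorProduct.mk k (H ⊗[k] H) (H ⊗[k] A)).flip (coact g)))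
        ((TensorProduct.assoc k H H (H ⊗[k] H)).symm (threeComul k WH h))))

/-- `(H, A)` is a weak matched pair. -/
structure IsWeakMatchedPair (WH : WeakBialgebra k H) (WA : WeakBialgebra k A)
    (act : H →ₗ[k] A →ₗ[k] A) (coact : H →ₗ[k] H ⊗[k] A) : Prop where
  moduleAlgebra : IsModuleAlgebra k WH act
  comoduleCoalgebra : IsComoduleCoalgebra k WH WA coact
  cond3 : ∀ (h g : H) (x : A),
    mpLHS k WH WA act coact h g x = mpRHS k WH WA act coact h g x
  cond4 : ∀ (h : H) (x : A), WA.εs (act h x) = WA.εs (act h 1) * WA.εs x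
  cond5 :
    (LinearMap.rTensor H coact) (WH.comul 1) =
      (TensorProduct.map (LinearMap.lTensor H (coactCounit k WH coact))
          (LinearMap.mul' k H))
        ((TensorProduct.tensorTensorTensorComm k H H H H)
          (WH.comul 1 ⊗ₜ[k] WH.comul 1))

/-- `(H, A)` is a compatible (abelian) weak matched pair. -/
structure IsCompatiblePair (WH : WeakBialgebra k H) (WA : WeakBialgebra k A)
    (act : H →ₗ[k] A →ₗ[k] A) (coact : H →ₗ[k] H ⊗[k] A) : Prop where
  pair : IsWeakMatchedPair k WH WA act coact
  cocomm : WH.Cocomm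
  comm : ∀ a b : A, a * b = b * a
  compat1 : ∀ h : H,
    act h 1 =
      (TensorProduct.rid k A)
        ((TensorProduct.map (TensorProduct.lift act)
            (WA.counit ∘ₗ TensorProduct.lift act))
          ((TensorProduct.tensorTensorTensorComm k H H A A)
            (WH.comul h ⊗ₜ[k] WA.comul 1)))
  compat2 : ∀ h g : H,
    (TensorProduct.map (act h) (act g)) (WA.comul 1) =
      (TensorProduct.map (LinearMap.mulLeft k (act h 1))
        (LinearMap.mulLeft k (act g 1))) (WA.comul 1)

/-- The smash product multiplication on `A ⊗ H`:
`(x ⊗ h) (y ⊗ g) = x (h₁ · y) ⊗ h₂ g`. -/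
def smashMul (WH : WeakBialgebra k H) (act : H →ₗ[k] A →ₗ[k] A) :
    (A ⊗[k] H) ⊗[k] (A ⊗[k] H) →ₗ[k] A ⊗[k] H :=
  LinearMap.rTensor H (LinearMap.mul' k A) ∘ₗ
  (TensorProduct.assoc k A A H).symm.toLinearMap ∘ₗ
  LinearMap.lTensor A
    (TensorProduct.map (TensorProduct.lift act) (LinearMap.mul' k H) ∘ₗ
      (TensorProduct.tensorTensorTensorComm k H H A H).toLinearMap) ∘ₗ
  (TensorProduct.assoc k A (H ⊗[k] H) (A ⊗[k] H)).toLinearMap ∘ₗ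
  LinearMap.rTensor (A ⊗[k] H) (LinearMap.lTensor A WH.comul)

/-- The smash coproduct on `A ⊗ H`:
`Δ(x ⊗ h) = (x₁ ⊗ h₁⁰) ⊗ (x₂ h₁¹ ⊗ h₂)`. -/
def smashComul (WH : WeakBialgebra k H) (WA : WeakBialgebra k A)
    (coact : H →ₗ[k] H ⊗[k] A) :
    A ⊗[k] H →ₗ[k] (A ⊗[k] H) ⊗[k] (A ⊗[k] H) :=
  (TensorProduct.assoc k (A ⊗[k] H) A H).toLinearMap ∘ₗ
  LinearMap.rTensor H (LinearMap.lTensor (A ⊗[k] H) (LinearMap.mul' k A)) ∘ₗ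
  LinearMap.rTensor H (TensorProduct.tensorTensorTensorComm k A A H A).toLinearMap ∘ₗ
  (TensorProduct.assoc k (A ⊗[k] A) (H ⊗[k] A) H).symm.toLinearMap ∘ₗ
  LinearMap.lTensor (A ⊗[k] A) (LinearMap.rTensor H coact) ∘ₗ
  TensorProduct.map WA.comul WH.comul

/-- The smash counit `ε(x ⊗ h) = ε(x) ε(h)`. -/
def smashCounit (WH : WeakBialgebra k H) (WA : WeakBialgebra k A) :
    A ⊗[k] H →ₗ[k] k :=
  LinearMap.mul' k k ∘ₗ TensorProduct.map WA.counit WH.counit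

/-- The projection `u ↦ u (1_A # 1_H)` onto `A ♯ H`. -/
def projUnder (WH : WeakBialgebra k H) (act : H →ₗ[k] A →ₗ[k] A) :
    A ⊗[k] H →ₗ[k] A ⊗[k] H :=
  smashMul k WH act ∘ₗ
    (TensorProduct.mk k (A ⊗[k] H) (A ⊗[k] H)).flip ((1 : A) ⊗ₜ[k] (1 : H))

/-- The projection `u ↦ (id ⊗ ε) Δ(u)` onto `overline(A # H)`. -/
def projBar (WH : WeakBialgebra k H) (WA : WeakBialgebra k A)
    (coact : H →ₗ[k] H ⊗[k] A) : A ⊗[k] H →ₗ[k] A ⊗[k] H :=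
  (TensorProduct.rid k (A ⊗[k] H)).toLinearMap ∘ₗ
    LinearMap.lTensor (A ⊗[k] H) (smashCounit k WH WA) ∘ₗ smashComul k WH WA coact

/-- The projection onto `A ♯♯ H`, i.e. `u ↦ (id ⊗ ε) Δ (u (1#1))`. -/
def projBoth (WH : WeakBialgebra k H) (WA : WeakBialgebra k A)
    (act : H →ₗ[k] A →ₗ[k] A) (coact : H →ₗ[k] H ⊗[k] A) :
    A ⊗[k] H →ₗ[k] A ⊗[k] H :=
  projBar k WH WA coact ∘ₗ projUnder k WH act

/-- Componentwise smash multiplication on `(A⊗H) ⊗ (A⊗H)`. -/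
def smashMul2 (WH : WeakBialgebra k H) (act : H →ₗ[k] A →ₗ[k] A) :
    ((A ⊗[k] H) ⊗[k] (A ⊗[k] H)) ⊗[k] ((A ⊗[k] H) ⊗[k] (A ⊗[k] H)) →ₗ[k]
      (A ⊗[k] H) ⊗[k] (A ⊗[k] H) :=
  TensorProduct.map (smashMul k WH act) (smashMul k WH act) ∘ₗ
    (TensorProduct.tensorTensorTensorComm k (A ⊗[k] H) (A ⊗[k] H)
      (A ⊗[k] H) (A ⊗[k] H)).toLinearMap

/-- Componentwise smash multiplication on threefold tensors. -/
def smashMul3 (WH : WeakBialgebra k H) (act : H →ₗ[k] A →ₗ[k] A) :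
    ((A ⊗[k] H) ⊗[k] ((A ⊗[k] H) ⊗[k] (A ⊗[k] H))) ⊗[k]
      ((A ⊗[k] H) ⊗[k] ((A ⊗[k] H) ⊗[k] (A ⊗[k] H))) →ₗ[k]
      (A ⊗[k] H) ⊗[k] ((A ⊗[k] H) ⊗[k] (A ⊗[k] H)) :=
  TensorProduct.map (smashMul k WH act) (smashMul2 k WH act) ∘ₗ
    (TensorProduct.tensorTensorTensorComm k (A ⊗[k] H)
      ((A ⊗[k] H) ⊗[k] (A ⊗[k] H)) (A ⊗[k] H)
      ((A ⊗[k] H) ⊗[k] (A ⊗[k] H))).toLinearMap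

/-- The unit element `1_A ♯♯ 1_H` of `A ♯♯ H`. -/
def smashOne (WH : WeakBialgebra k H) (WA : WeakBialgebra k A)
    (act : H →ₗ[k] A →ₗ[k] A) (coact : H →ₗ[k] H ⊗[k] A) : A ⊗[k] H :=
  projBoth k WH WA act coact ((1 : A) ⊗ₜ[k] (1 : H))

/-- The map `εt` of the weak bialgebra `A ♯♯ H`: `u ↦ ε(e₁ u) e₂` where `e = 1_A ♯♯ 1_H`. -/
def smashEpsT (WH : WeakBialgebra k H) (WA : WeakBialgebra k A)
    (act : H →ₗ[k] A →ₗ[k] A) (coact : H →ₗ[k] H ⊗[k] A) (u : A ⊗[k] H) :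
    A ⊗[k] H :=
  (TensorProduct.lid k (A ⊗[k] H))
    ((LinearMap.rTensor (A ⊗[k] H)
        (smashCounit k WH WA ∘ₗ smashMul k WH act ∘ₗ
          (TensorProduct.mk k (A ⊗[k] H) (A ⊗[k] H)).flip u))
      (smashComul k WH WA coact (smashOne k WH WA act coact)))

/-- The map `εs` of the weak bialgebra `A ♯♯ H`: `u ↦ e₁ ε(u e₂)` where `e = 1_A ♯♯ 1_H`. -/
def smashEpsS (WH : WeakBialgebra k H) (WA : WeakBialgebra k A)
    (act : H →ₗ[k] A →ₗ[k] A) (coact : H →ₗ[k] H ⊗[k] A) (u : A ⊗[k] H) :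
    A ⊗[k] H :=
  (TensorProduct.rid k (A ⊗[k] H))
    ((LinearMap.lTensor (A ⊗[k] H)
        (smashCounit k WH WA ∘ₗ smashMul k WH act ∘ₗ
          TensorProduct.mk k (A ⊗[k] H) (A ⊗[k] H) u))
      (smashComul k WH WA coact (smashOne k WH WA act coact)))

/-- The antipode of `A ♯♯ H`:
`S(x ⊗ h) = (1_A ♯♯ S_H(h⁰)) ((S_A(x h¹)) ♯♯ 1_H)`. -/
def smashAntipode (WH : WeakBialgebra k H) (WA : WeakBialgebra k A)
    (act : H →ₗ[k] A →ₗ[k] A) (coact : H →ₗ[k] H ⊗[k] A)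
    (SH : H →ₗ[k] H) (SA : A →ₗ[k] A) : A ⊗[k] H →ₗ[k] A ⊗[k] H :=
  smashMul k WH act ∘ₗ
  TensorProduct.map
    (projBoth k WH WA act coact ∘ₗ TensorProduct.mk k A H 1)
    (projBoth k WH WA act coact ∘ₗ (TensorProduct.mk k A H).flip 1) ∘ₗ
  (TensorProduct.comm k A H).toLinearMap ∘ₗ
  TensorProduct.map (SA ∘ₗ LinearMap.mul' k A) SH ∘ₗ
  (TensorProduct.assoc k A A H).symm.toLinearMap ∘ₗ
  LinearMap.lTensor A ((TensorProduct.comm k H A).toLinearMap ∘ₗ coact)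

/-- LHS of condition (7): `(1_{H1} h⁰ · 1_A) ⊗ S_A(h¹) εs(1_{H2}¹) ⊗ 1_{H2}⁰`. -/
def cond7LHS (WH : WeakBialgebra k H) (WA : WeakBialgebra k A)
    (act : H →ₗ[k] A →ₗ[k] A) (coact : H →ₗ[k] H ⊗[k] A)
    (SA : A →ₗ[k] A) (h : H) : (A ⊗[k] A) ⊗[k] H :=
  (TensorProduct.assoc k A A H).symm
    ((TensorProduct.map
        (act.flip 1 ∘ₗ LinearMap.mul' k H)
        ((TensorProduct.comm k H A).toLinearMap ∘ₗ
          LinearMap.lTensor H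
            (LinearMap.mul' k A ∘ₗ TensorProduct.map SA WA.εs ∘ₗ
              (TensorProduct.comm k A A).toLinearMap) ∘ₗ
          (TensorProduct.assoc k H A A).toLinearMap ∘ₗ
          LinearMap.rTensor A coact))
      ((TensorProduct.tensorTensorTensorComm k H H H A)
        (WH.comul 1 ⊗ₜ[k] coact h)))

/-- RHS of condition (7):
`εt(1_{H1}⁰ h⁰ · 1_A) ⊗ εt(h¹) εs(1_{H2}¹) 1_{H1}¹ ⊗ 1_{H2}⁰`. -/
def cond7RHS (WH : WeakBialgebra k H) (WA : WeakBialgebra k A)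
    (act : H →ₗ[k] A →ₗ[k] A) (coact : H →ₗ[k] H ⊗[k] A) (h : H) :
    (A ⊗[k] A) ⊗[k] H :=
  (TensorProduct.assoc k A A H).symm
   ((LinearMap.lTensor A (TensorProduct.comm k H A).toLinearMap)
    ((TensorProduct.assoc k A H A)
     ((LinearMap.lTensor (A ⊗[k] H)
        (LinearMap.mul' k A ∘ₗ (TensorProduct.comm k A A).toLinearMap))
      ((TensorProduct.tensorTensorTensorComm k A A H A)
       ((LinearMap.lTensor (A ⊗[k] A) (TensorProduct.comm k A H).toLinearMap)
        ((TensorProduct.map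
            (LinearMap.rTensor A (WA.εt ∘ₗ act.flip 1 ∘ₗ LinearMap.mul' k H) ∘ₗ
              (TensorProduct.assoc k H H A).symm.toLinearMap ∘ₗ
              LinearMap.lTensor H (TensorProduct.comm k A H).toLinearMap ∘ₗ
              (TensorProduct.assoc k H A H).toLinearMap)
            (LinearMap.rTensor H
                (LinearMap.mul' k A ∘ₗ (TensorProduct.comm k A A).toLinearMap ∘ₗ
                  TensorProduct.map WA.εs WA.εt) ∘ₗ
              (TensorProduct.assoc k A A H).symm.toLinearMap ∘ₗ
              LinearMap.lTensor A (TensorProduct.comm k H A).toLinearMap ∘ₗ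
              (TensorProduct.assoc k A H A).toLinearMap ∘ₗ
              LinearMap.rTensor A (TensorProduct.comm k H A).toLinearMap))
          ((TensorProduct.tensorTensorTensorComm k (H ⊗[k] A) (H ⊗[k] A) H A)
            (((TensorProduct.map coact coact) (WH.comul 1)) ⊗ₜ[k] coact h))))))))

/-- LHS of condition (8):
`εs(h₁¹ h₂¹) (S_H(h₁⁰) · 1_A) ⊗ S_H(h₂⁰) h₃`. -/
def cond8LHS (WH : WeakBialgebra k H) (WA : WeakBialgebra k A)
    (act : H →ₗ[k] A →ₗ[k] A) (coact : H →ₗ[k] H ⊗[k] A)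
    (SH : H →ₗ[k] H) (h : H) : A ⊗[k] H :=
  LinearMap.rTensor H (LinearMap.mul' k A)
   ((TensorProduct.assoc k A A H).symm
    ((TensorProduct.map
        (WA.εs ∘ₗ LinearMap.mul' k A)
        (TensorProduct.map (act.flip 1 ∘ₗ SH)
          (LinearMap.mul' k H ∘ₗ LinearMap.rTensor H SH)))
      ((TensorProduct.tensorTensorTensorComm k A H A (H ⊗[k] H))
        ((TensorProduct.map (TensorProduct.comm k H A).toLinearMap
            ((TensorProduct.assoc k A H H).toLinearMap ∘ₗ
              LinearMap.rTensor H (TensorProduct.comm k H A).toLinearMap))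
          ((TensorProduct.map coact (LinearMap.rTensor H coact))
            (twoComul k WH h))))))

/-- RHS of condition (8):
`εs(h¹ 1_{H2}¹) εs(h⁰ 1_{H1} · 1_A) ⊗ 1_{H2}⁰`. -/
def cond8RHS (WH : WeakBialgebra k H) (WA : WeakBialgebra k A)
    (act : H →ₗ[k] A →ₗ[k] A) (coact : H →ₗ[k] H ⊗[k] A) (h : H) :
    A ⊗[k] H :=
  LinearMap.rTensor H (LinearMap.mul' k A ∘ₗ (TensorProduct.comm k A A).toLinearMap)
   ((TensorProduct.assoc k A A H).symm
    ((TensorProduct.map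
        (WA.εs ∘ₗ act.flip 1 ∘ₗ LinearMap.mul' k H)
        (LinearMap.rTensor H (WA.εs ∘ₗ LinearMap.mul' k A) ∘ₗ
          (TensorProduct.assoc k A A H).symm.toLinearMap ∘ₗ
          LinearMap.lTensor A (TensorProduct.comm k H A).toLinearMap))
      ((TensorProduct.tensorTensorTensorComm k H A H (H ⊗[k] A))
        (coact h ⊗ₜ[k] (LinearMap.lTensor H coact) (WH.comul 1)))))

/-- The element `εs(t₁¹ (t₂ · 1_A)) ⊗ t₁⁰` of `A ⊗ H`. -/
def integralWitness (WH : WeakBialgebra k H) (WA : WeakBialgebra k A)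
    (act : H →ₗ[k] A →ₗ[k] A) (coact : H →ₗ[k] H ⊗[k] A) (t : H) :
    A ⊗[k] H :=
  (TensorProduct.comm k H A)
    ((LinearMap.lTensor H (WA.εs ∘ₗ LinearMap.mul' k A))
      ((TensorProduct.assoc k H A A)
        ((LinearMap.rTensor A coact)
          ((LinearMap.lTensor H (act.flip 1)) (WH.comul t)))))

end MatchedPair

end WeakSmash


namespace WeakSmash

section SmashProduct

variable {k H A : Type*} [Field k] [Ring H] [Algebra k H] [Ring A] [Algebra k A]

set_option synthInstance.maxHeartbeats 200000 in
theorem smashMul_tmul (WH : WeakBialgebra k H) (act : H →ₗ[k] A →ₗ[k] A)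
    (x : A) (h : H) (y : A) (g : H) :
    smashMul k WH act ((x ⊗ₜ[k] h) ⊗ₜ[k] (y ⊗ₜ[k] g)) =
      TensorProduct.map (LinearMap.mulLeft k x ∘ₗ act.flip y) (LinearMap.mulRight k g)
        (WH.comul h) := by
  simp only [smashMul, LinearMap.comp_apply, LinearMap.rTensor_tmul, LinearMap.lTensor_tmul]
  generalize WH.comul h = t
  induction t using TensorProduct.induction_on with
  | zero => simp
  | tmul a b => simp
  | add a b ha hb =>
    simp only [map_add, TensorProduct.add_tmul, TensorProduct.tmul_add] at ha hb ⊢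
    rw [ha, hb]

/-- The map `a ⊗ (b ⊗ c) ↦ x (a · y) (b s₁ · z) ⊗ c s₂ l` for `s = s₁ ⊗ s₂`. -/
def tripleSmash (act : H →ₗ[k] A →ₗ[k] A) (x y z : A) (l : H) (s : H ⊗[k] H) :
    H ⊗[k] (H ⊗[k] H) →ₗ[k] A ⊗[k] H :=
  LinearMap.rTensor H (LinearMap.mul' k A) ∘ₗ
    (TensorProduct.assoc k A A H).symm.toLinearMap ∘ₗ
    TensorProduct.map (LinearMap.mulLeft k x ∘ₗ act.flip y)
      (TensorProduct.map (act.flip z) (LinearMap.mulRight k l) ∘ₗ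
        (LinearMap.mul k (H ⊗[k] H)).flip s)

theorem tripleSmash_add (act : H →ₗ[k] A →ₗ[k] A) (x y z : A) (l : H) (s s' : H ⊗[k] H) :
    tripleSmash act x y z l (s + s') = tripleSmash act x y z l s + tripleSmash act x y z l s' := by
  simp only [tripleSmash, map_add, LinearMap.comp_add, TensorProduct.map_add_right]

theorem tripleSmash_zero (act : H →ₗ[k] A →ₗ[k] A) (x y z : A) (l : H) :
    tripleSmash act x y z l 0 = 0 := by
  simp only [tripleSmash, map_zero, LinearMap.comp_zero, TensorProduct.map_zero_right]

theorem tripleSmash_tmul (act : H →ₗ[k] A →ₗ[k] A) (x y z : A) (l a b c p q : H) :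
    tripleSmash act x y z l (p ⊗ₜ[k] q) (a ⊗ₜ[k] (b ⊗ₜ[k] c)) =
      (x * act a y * act (b * p) z) ⊗ₜ[k] (c * q * l) := by
  simp [tripleSmash]

theorem tripleSmash_mul (act : H →ₗ[k] A →ₗ[k] A) (x y z : A) (l : H) (s w : H ⊗[k] H)
    (r : H ⊗[k] (H ⊗[k] H)) :
    tripleSmash act x y z l s (r * ((1 : H) ⊗ₜ[k] w)) = tripleSmash act x y z l (w * s) r := by
  induction r using TensorProduct.induction_on with
  | zero => simp
  | tmul a b => simp [tripleSmash, mul_assoc]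
  | add a b ha hb => rw [add_mul, map_add, map_add, ha, hb]

theorem smashMul_map_left (WH : WeakBialgebra k H) (act : H →ₗ[k] A →ₗ[k] A)
    (x y z : A) (l g : H) (t : H ⊗[k] H) :
    smashMul k WH act
        (TensorProduct.map (LinearMap.mulLeft k x ∘ₗ act.flip y) (LinearMap.mulRight k g) t ⊗ₜ[k]
          (z ⊗ₜ[k] l)) =
      tripleSmash act x y z l (WH.comul g) (LinearMap.lTensor H WH.comul t) := by
  induction t using TensorProduct.induction_on with
  | zero => simp
  | tmul a b =>
    simp only [TensorProduct.map_tmul, LinearMap.comp_apply, LinearMap.mulLeft_apply,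
      LinearMap.mulRight_apply, LinearMap.flip_apply, smashMul_tmul, WH.comul_mul,
      LinearMap.lTensor_tmul]
    generalize WH.comul g = s
    generalize WH.comul b = r
    induction s using TensorProduct.induction_on with
    | zero => simp [tripleSmash_zero]
    | add s s' hs hs' => rw [mul_add, map_add, tripleSmash_add, LinearMap.add_apply, hs, hs']
    | tmul c d =>
      induction r using TensorProduct.induction_on with
      | zero => simp
      | tmul p q => simp [tripleSmash_tmul, mul_assoc]
      | add r r' hr hr' => rw [add_mul, map_add, hr, hr', TensorProduct.tmul_add, map_add]
  | add a b ha hb => rw [map_add, TensorProduct.add_tmul, map_add, map_add, map_add, ha, hb]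

theorem smashMul_map_right (WH : WeakBialgebra k H) {act : H →ₗ[k] A →ₗ[k] A}
    (hMA : IsModuleAlgebra k WH act) (x y z : A) (l h : H) (s : H ⊗[k] H) :
    smashMul k WH act ((x ⊗ₜ[k] h) ⊗ₜ[k]
        TensorProduct.map (LinearMap.mulLeft k y ∘ₗ act.flip z) (LinearMap.mulRight k l) s) =
      tripleSmash act x y z l s (LinearMap.lTensor H WH.comul (WH.comul h)) := by
  rw [← WH.coassoc]
  induction s using TensorProduct.induction_on with
  | zero => simp [tripleSmash_zero]
  | add s s' hs hs' =>
    rw [map_add, TensorProduct.tmul_add, map_add, tripleSmash_add, LinearMap.add_apply, hs, hs']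
  | tmul c d =>
    simp only [TensorProduct.map_tmul, LinearMap.comp_apply, LinearMap.mulLeft_apply,
      LinearMap.mulRight_apply, LinearMap.flip_apply, smashMul_tmul]
    generalize WH.comul h = t
    induction t using TensorProduct.induction_on with
    | zero => simp
    | add t t' ht ht' => simp only [map_add, ht, ht']
    | tmul a b =>
      simp only [TensorProduct.map_tmul, LinearMap.comp_apply, LinearMap.mulLeft_apply,
        LinearMap.mulRight_apply, LinearMap.flip_apply, LinearMap.rTensor_tmul, hMA.act_mul]
      generalize WH.comul a = r
      induction r using TensorProduct.induction_on with
      | zero => simp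
      | tmul p q => simp [tripleSmash_tmul, hMA.act_act, mul_assoc]
      | add r r' hr hr' =>
        simp only [map_add, mul_add, TensorProduct.add_tmul, hr, hr']

theorem smashMul_assoc (WH : WeakBialgebra k H) {act : H →ₗ[k] A →ₗ[k] A}
    (hMA : IsModuleAlgebra k WH act) (u v w : A ⊗[k] H) :
    smashMul k WH act (smashMul k WH act (u ⊗ₜ[k] v) ⊗ₜ[k] w) =
      smashMul k WH act (u ⊗ₜ[k] smashMul k WH act (v ⊗ₜ[k] w)) := by
  induction u using TensorProduct.induction_on with
  | zero => simp
  | add u u' hu hu' => simp only [TensorProduct.add_tmul, map_add, hu, hu']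
  | tmul x h =>
    induction v using TensorProduct.induction_on with
    | zero => simp
    | add v v' hv hv' => simp only [TensorProduct.add_tmul, TensorProduct.tmul_add, map_add, hv, hv']
    | tmul y g =>
      induction w using TensorProduct.induction_on with
      | zero => simp
      | add w w' hw hw' => simp only [TensorProduct.tmul_add, map_add, hw, hw']
      | tmul z l =>
        rw [smashMul_tmul, smashMul_map_left, smashMul_tmul, smashMul_map_right WH hMA]

theorem smashMul_projUnder_left (WH : WeakBialgebra k H) {act : H →ₗ[k] A →ₗ[k] A}
    (hMA : IsModuleAlgebra k WH act) (u v : A ⊗[k] H) :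
    smashMul k WH act (projUnder k WH act u ⊗ₜ[k] v) = smashMul k WH act (u ⊗ₜ[k] v) := by
  induction u using TensorProduct.induction_on with
  | zero => simp
  | add u u' hu hu' => simp only [TensorProduct.add_tmul, map_add, hu, hu']
  | tmul x h =>
    induction v using TensorProduct.induction_on with
    | zero => simp
    | add v v' hv hv' => simp only [TensorProduct.tmul_add, map_add, hv, hv']
    | tmul y g =>
      have act_mul_one : ∀ a : H, act a y =
          LinearMap.mul' k A (TensorProduct.map (act.flip 1) (act.flip y) (WH.comul a)) := by
        intro a
        rw [← hMA.act_mul, one_mul]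
      have comul_mul_one : ∀ b : H, WH.comul b * WH.comul 1 = WH.comul b := by
        intro b
        rw [← WH.comul_mul, mul_one]
      simp only [projUnder, LinearMap.comp_apply, LinearMap.flip_apply, TensorProduct.mk_apply]
      have triple : ∀ t : H ⊗[k] H,
          tripleSmash act x 1 y g (WH.comul 1) (LinearMap.lTensor H WH.comul t) =
            tripleSmash act x 1 y g 1 (LinearMap.lTensor H WH.comul t) := by
        intro t
        induction t using TensorProduct.induction_on with
        | zero => simp
        | add t t' ht ht' => rw [map_add, map_add, map_add, ht, ht']
        | tmul a b => simp [tripleSmash, comul_mul_one]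
      rw [smashMul_tmul, smashMul_map_left, triple, ← WH.coassoc, smashMul_tmul]
      generalize WH.comul h = t
      induction t using TensorProduct.induction_on with
      | zero => simp
      | add t t' ht ht' => simp only [map_add, ht, ht']
      | tmul a b =>
        simp only [TensorProduct.map_tmul, LinearMap.comp_apply, LinearMap.mulLeft_apply,
          LinearMap.mulRight_apply, LinearMap.flip_apply, LinearMap.rTensor_tmul, act_mul_one a]
        generalize WH.comul a = r
        induction r using TensorProduct.induction_on with
        | zero => simp
        | tmul p q => simp [Algebra.TensorProduct.one_def, tripleSmash_tmul, mul_assoc]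
        | add r r' hr hr' => simp only [map_add, mul_add, TensorProduct.add_tmul, hr, hr']

theorem one_smashMul_mul_one (WH : WeakBialgebra k H) {act : H →ₗ[k] A →ₗ[k] A}
    (hMA : IsModuleAlgebra k WH act) (v : A ⊗[k] H) :
    smashMul k WH act (((1 : A) ⊗ₜ[k] (1 : H)) ⊗ₜ[k] projUnder k WH act v) =
      projUnder k WH act v := by
  induction v using TensorProduct.induction_on with
  | zero => simp
  | add v v' hv hv' => simp only [TensorProduct.tmul_add, map_add, hv, hv']
  | tmul y g =>
    simp only [projUnder, LinearMap.comp_apply, LinearMap.flip_apply, TensorProduct.mk_apply]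
    rw [smashMul_tmul, smashMul_map_right WH hMA, ← WH.comul_one_left, tripleSmash_mul,
      ← WH.comul_mul, one_mul]
    generalize WH.comul g = s
    induction s using TensorProduct.induction_on with
    | zero => simp [tripleSmash_zero]
    | add s s' hs hs' => rw [tripleSmash_add, LinearMap.add_apply, hs, hs', map_add]
    | tmul c d =>
      have key : ∀ t : H ⊗[k] H,
          tripleSmash act 1 y 1 1 (c ⊗ₜ[k] d) (TensorProduct.assoc k H H H (t ⊗ₜ[k] (1 : H))) =
            LinearMap.mul' k A (TensorProduct.map (act.flip y) (act.flip (act c 1)) t) ⊗ₜ[k] d := by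
        intro t
        induction t using TensorProduct.induction_on with
        | zero => simp
        | add t t' ht ht' => simp only [TensorProduct.add_tmul, map_add, ht, ht']
        | tmul a b => simp [tripleSmash_tmul, hMA.act_act]
      rw [key, ← hMA.act_mul, hMA.one_act]
      simp

end SmashProduct

theorem smash_underline_algebra
    {k H A : Type*} [Field k] [Ring H] [Algebra k H] [Ring A] [Algebra k A]
    (WH : WeakBialgebra k H) (WA : WeakBialgebra k A)
    (act : H →ₗ[k] A →ₗ[k] A) (hMA : IsModuleAlgebra k WH act) :
    (∀ u v w : A ⊗[k] H,
        smashMul k WH act (smashMul k WH act (u ⊗ₜ[k] v) ⊗ₜ[k] w) =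
          smashMul k WH act (u ⊗ₜ[k] smashMul k WH act (v ⊗ₜ[k] w))) ∧
    (∀ (x y : A) (h g : H),
        smashMul k WH act
            (projUnder k WH act (x ⊗ₜ[k] h) ⊗ₜ[k] projUnder k WH act (y ⊗ₜ[k] g)) =
          projUnder k WH act (smashMul k WH act ((x ⊗ₜ[k] h) ⊗ₜ[k] (y ⊗ₜ[k] g)))) ∧
    (∀ (x y : A) (h g : H),
        smashMul k WH act
            (projUnder k WH act (x ⊗ₜ[k] h) ⊗ₜ[k] projUnder k WH act (y ⊗ₜ[k] g)) ∈
          LinearMap.range (projUnder k WH act)) ∧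
    (∀ u ∈ LinearMap.range (projUnder k WH act),
        smashMul k WH act (u ⊗ₜ[k] projUnder k WH act ((1 : A) ⊗ₜ[k] (1 : H))) = u ∧
        smashMul k WH act (projUnder k WH act ((1 : A) ⊗ₜ[k] (1 : H)) ⊗ₜ[k] u) = u) := by
  have smashMul_one : ∀ u : A ⊗[k] H,
      smashMul k WH act (u ⊗ₜ[k] ((1 : A) ⊗ₜ[k] (1 : H))) = projUnder k WH act u := fun _ => rfl
  have closed : ∀ u v : A ⊗[k] H,
      smashMul k WH act (projUnder k WH act u ⊗ₜ[k] projUnder k WH act v) =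
        projUnder k WH act (smashMul k WH act (u ⊗ₜ[k] v)) := by
    intro u v
    rw [smashMul_projUnder_left WH hMA, ← smashMul_one v, ← smashMul_assoc WH hMA, smashMul_one]
  refine ⟨smashMul_assoc WH hMA, fun x y h g => closed _ _, fun x y h g => ⟨_, (closed _ _).symm⟩,
    ?_⟩
  rintro _ ⟨v, rfl⟩
  constructor
  · rw [closed, smashMul_one, ← smashMul_one (projUnder k WH act v),
      smashMul_projUnder_left WH hMA, smashMul_one]
  · rw [smashMul_projUnder_left WH hMA, one_smashMul_mul_one WH hMA]

end WeakSmash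
end
end

section
/- Let H and A be weak bialgebras such that H is a right A-comodule coalgebra. Then the subspace overline(A#H) = (id⊗ε)Δ(A#H) of A#H is a coalgebra with coproduct Δ and counit ε: for all x ∈ A, h ∈ H one has Δ(overline(x#h)) = overline(x₁#(h₁)⁰) ⊗ overline(x₂(h₁)¹#h₂), which lies in overline(A#H)⊗overline(A#H), and (ε⊗id)Δ(overline(x#h)) = overline(x#h) = (id⊗ε)Δ(overline(x#h)). -/
open TensorProduct

noncomputable section

namespace WeakSmash

section Coassociative

variable {k C : Type*} [Field k] [AddCommGroup C] [Module k C]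
  {Δ : C →ₗ[k] C ⊗[k] C} {ε : C →ₗ[k] k} {p q : C →ₗ[k] C}

theorem lTensor_rightProj_comul
    (hΔ : ∀ c, TensorProduct.assoc k C C C (LinearMap.rTensor C Δ (Δ c)) =
      LinearMap.lTensor C Δ (Δ c))
    (hp : ∀ c, p c = TensorProduct.rid k C (LinearMap.lTensor C ε (Δ c))) (c : C) :
    LinearMap.lTensor C p (Δ c) = Δ (p c) := by
  have h1 : ∀ y : C ⊗[k] C, LinearMap.lTensor C p y =
      LinearMap.lTensor C ((TensorProduct.rid k C).toLinearMap ∘ₗ LinearMap.lTensor C ε)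
        (LinearMap.lTensor C Δ y) := by
    intro y
    induction y with
    | zero => simp
    | add a b ha hb => simp only [map_add, ha, hb]
    | tmul a b => simp [hp]
  have h2 : ∀ y : (C ⊗[k] C) ⊗[k] C,
      LinearMap.lTensor C ((TensorProduct.rid k C).toLinearMap ∘ₗ LinearMap.lTensor C ε)
        (TensorProduct.assoc k C C C y) =
      TensorProduct.rid k (C ⊗[k] C) (LinearMap.lTensor (C ⊗[k] C) ε y) := by
    intro y
    induction y with
    | zero => simp
    | add a b ha hb => simp only [map_add, ha, hb]
    | tmul a b =>
      induction a with
      | zero => simp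
      | add a b ha hb => simp only [map_add, TensorProduct.add_tmul, ha, hb]
      | tmul a d => simp
  have h3 : ∀ y : C ⊗[k] C,
      TensorProduct.rid k (C ⊗[k] C)
        (LinearMap.lTensor (C ⊗[k] C) ε (LinearMap.rTensor C Δ y)) =
      Δ (TensorProduct.rid k C (LinearMap.lTensor C ε y)) := by
    intro y
    induction y with
    | zero => simp
    | add a b ha hb => simp only [map_add, ha, hb]
    | tmul a b => simp
  rw [h1, ← hΔ, h2, h3, hp]

theorem rTensor_rightProj_comul
    (hΔ : ∀ c, TensorProduct.assoc k C C C (LinearMap.rTensor C Δ (Δ c)) =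
      LinearMap.lTensor C Δ (Δ c))
    (hp : ∀ c, p c = TensorProduct.rid k C (LinearMap.lTensor C ε (Δ c)))
    (hq : ∀ c, q c = TensorProduct.lid k C (LinearMap.rTensor C ε (Δ c))) (c : C) :
    LinearMap.rTensor C p (Δ c) = LinearMap.lTensor C q (Δ c) := by
  have h1 : ∀ y : C ⊗[k] C, LinearMap.rTensor C p y =
      LinearMap.rTensor C ((TensorProduct.rid k C).toLinearMap ∘ₗ LinearMap.lTensor C ε)
        (LinearMap.rTensor C Δ y) := by
    intro y
    induction y with
    | zero => simp
    | add a b ha hb => simp only [map_add, ha, hb]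
    | tmul a b => simp [hp]
  have h2 : ∀ y : C ⊗[k] C, LinearMap.lTensor C q y =
      LinearMap.lTensor C ((TensorProduct.lid k C).toLinearMap ∘ₗ LinearMap.rTensor C ε)
        (LinearMap.lTensor C Δ y) := by
    intro y
    induction y with
    | zero => simp
    | add a b ha hb => simp only [map_add, ha, hb]
    | tmul a b => simp [hq]
  have h3 : ∀ y : (C ⊗[k] C) ⊗[k] C,
      LinearMap.rTensor C ((TensorProduct.rid k C).toLinearMap ∘ₗ LinearMap.lTensor C ε) y =
      LinearMap.lTensor C ((TensorProduct.lid k C).toLinearMap ∘ₗ LinearMap.rTensor C ε)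
        (TensorProduct.assoc k C C C y) := by
    intro y
    induction y with
    | zero => simp
    | add a b ha hb => simp only [map_add, ha, hb]
    | tmul a b =>
      induction a with
      | zero => simp
      | add a b ha hb => simp only [map_add, TensorProduct.add_tmul, ha, hb]
      | tmul a d => simp [TensorProduct.smul_tmul]
  rw [h1, h2, ← hΔ, h3]

theorem leftProj_rightProj_comm
    (hΔ : ∀ c, TensorProduct.assoc k C C C (LinearMap.rTensor C Δ (Δ c)) =
      LinearMap.lTensor C Δ (Δ c))
    (hp : ∀ c, p c = TensorProduct.rid k C (LinearMap.lTensor C ε (Δ c)))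
    (hq : ∀ c, q c = TensorProduct.lid k C (LinearMap.rTensor C ε (Δ c))) (c : C) :
    q (p c) = p (q c) := by
  have h1 : ∀ y : C ⊗[k] C,
      TensorProduct.lid k C (LinearMap.rTensor C ε (LinearMap.lTensor C p y)) =
        p (TensorProduct.lid k C (LinearMap.rTensor C ε y)) := by
    intro y
    induction y with
    | zero => simp
    | add a b ha hb => simp only [map_add, ha, hb]
    | tmul a b => simp
  rw [hq, ← lTensor_rightProj_comul hΔ hp, h1, hq]

theorem map_rightProj_comul
    (hΔ : ∀ c, TensorProduct.assoc k C C C (LinearMap.rTensor C Δ (Δ c)) =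
      LinearMap.lTensor C Δ (Δ c))
    (hp : ∀ c, p c = TensorProduct.rid k C (LinearMap.lTensor C ε (Δ c)))
    (hq : ∀ c, q c = TensorProduct.lid k C (LinearMap.rTensor C ε (Δ c)))
    (hpq : p ∘ₗ q = p) (c : C) :
    Δ (p c) = TensorProduct.map p p (Δ c) := by
  rw [← LinearMap.lTensor_comp_rTensor, LinearMap.comp_apply,
    rTensor_rightProj_comul hΔ hp hq, ← LinearMap.lTensor_comp_apply, hpq,
    lTensor_rightProj_comul hΔ hp]

end Coassociative

section SmashCoproduct

variable {k H A : Type*} [Field k] [Ring H] [Algebra k H] [Ring A] [Algebra k A]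

/-- The map `(b ⊗ r) ⊗ ((x ⊗ s) ⊗ y) ↦ (b ⊗ x) ⊗ (r s ⊗ y)`. -/
def shuffleMul (k B R X Y : Type*) [Field k] [Ring R] [Algebra k R]
    [AddCommGroup B] [Module k B] [AddCommGroup X] [Module k X] [AddCommGroup Y] [Module k Y] :
    (B ⊗[k] R) ⊗[k] ((X ⊗[k] R) ⊗[k] Y) →ₗ[k] (B ⊗[k] X) ⊗[k] (R ⊗[k] Y) :=
  (TensorProduct.assoc k (B ⊗[k] X) R Y).toLinearMap ∘ₗ
  LinearMap.rTensor Y (LinearMap.lTensor (B ⊗[k] X) (LinearMap.mul' k R)) ∘ₗ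
  LinearMap.rTensor Y (TensorProduct.tensorTensorTensorComm k B R X R).toLinearMap ∘ₗ
  (TensorProduct.assoc k (B ⊗[k] R) (X ⊗[k] R) Y).symm.toLinearMap

@[simp]
theorem shuffleMul_tmul {B R X Y : Type*} [Ring R] [Algebra k R]
    [AddCommGroup B] [Module k B] [AddCommGroup X] [Module k X] [AddCommGroup Y] [Module k Y]
    (b : B) (r : R) (x : X) (s : R) (y : Y) :
    shuffleMul k B R X Y ((b ⊗ₜ r) ⊗ₜ ((x ⊗ₜ s) ⊗ₜ y)) = (b ⊗ₜ x) ⊗ₜ ((r * s) ⊗ₜ y) := by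
  simp [shuffleMul]

/-- The map `(b ⊗ r) ⊗ (x ⊗ s) ↦ ε(r s) (b ⊗ x)`. -/
def shuffleCounit (B X : Type*) [AddCommGroup B] [Module k B] [AddCommGroup X] [Module k X]
    (ε : A →ₗ[k] k) : (B ⊗[k] A) ⊗[k] (X ⊗[k] A) →ₗ[k] B ⊗[k] X :=
  (TensorProduct.rid k (B ⊗[k] X)).toLinearMap ∘ₗ
  LinearMap.lTensor (B ⊗[k] X) (ε ∘ₗ LinearMap.mul' k A) ∘ₗ
  (TensorProduct.tensorTensorTensorComm k B A X A).toLinearMap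

@[simp]
theorem shuffleCounit_tmul {B X : Type*} [AddCommGroup B] [Module k B]
    [AddCommGroup X] [Module k X] (ε : A →ₗ[k] k) (b : B) (r : A) (x : X) (s : A) :
    shuffleCounit B X ε ((b ⊗ₜ r) ⊗ₜ (x ⊗ₜ s)) = ε (r * s) • (b ⊗ₜ[k] x) := by
  simp [shuffleCounit]

theorem smashComul_tmul (WH : WeakBialgebra k H) (WA : WeakBialgebra k A)
    (coact : H →ₗ[k] H ⊗[k] A) (x : A) (h : H) :
    smashComul k WH WA coact (x ⊗ₜ h) =
      shuffleMul k A A H H (WA.comul x ⊗ₜ LinearMap.rTensor H coact (WH.comul h)) := by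
  simp [smashComul, shuffleMul]

theorem rTensor_smashComul_shuffleMul (WH : WeakBialgebra k H) (WA : WeakBialgebra k A)
    (coact : H →ₗ[k] H ⊗[k] A) (t : A ⊗[k] A) (u : (H ⊗[k] A) ⊗[k] H) :
    LinearMap.rTensor (A ⊗[k] H) (smashComul k WH WA coact)
        (shuffleMul k A A H H (t ⊗ₜ u)) =
      LinearMap.rTensor (A ⊗[k] H) (shuffleMul k A A H H)
        (shuffleMul k (A ⊗[k] A) A ((H ⊗[k] A) ⊗[k] H) H
          (LinearMap.rTensor A WA.comul t ⊗ₜ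
            LinearMap.rTensor H
              (LinearMap.rTensor A (LinearMap.rTensor H coact ∘ₗ WH.comul)) u)) := by
  induction t with
  | zero => simp
  | add a b ha hb => simp only [map_add, TensorProduct.add_tmul, ha, hb]
  | tmul a b =>
    induction u with
    | zero => simp
    | add u v hu hv => simp only [map_add, TensorProduct.tmul_add, hu, hv]
    | tmul u g =>
      induction u with
      | zero => simp
      | add u v hu hv =>
        simp only [map_add, TensorProduct.tmul_add, TensorProduct.add_tmul, hu, hv]
      | tmul h c => simp [smashComul_tmul]

theorem lTensor_smashComul_shuffleMul (WH : WeakBialgebra k H) (WA : WeakBialgebra k A)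
    (coact : H →ₗ[k] H ⊗[k] A) (t : A ⊗[k] A) (u : (H ⊗[k] A) ⊗[k] H) :
    LinearMap.lTensor (A ⊗[k] H) (smashComul k WH WA coact)
        (shuffleMul k A A H H (t ⊗ₜ u)) =
      LinearMap.lTensor (A ⊗[k] H) (shuffleMul k A A H H)
        (shuffleMul k A (A ⊗[k] A) H ((H ⊗[k] A) ⊗[k] H)
          (LinearMap.lTensor A WA.comul t ⊗ₜ
            TensorProduct.map (LinearMap.lTensor H WA.comul)
              (LinearMap.rTensor H coact ∘ₗ WH.comul) u)) := by
  induction t with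
  | zero => simp
  | add a b ha hb => simp only [map_add, TensorProduct.add_tmul, ha, hb]
  | tmul a b =>
    induction u with
    | zero => simp
    | add u v hu hv => simp only [map_add, TensorProduct.tmul_add, hu, hv]
    | tmul u g =>
      induction u with
      | zero => simp
      | add u v hu hv =>
        simp only [map_add, TensorProduct.tmul_add, TensorProduct.add_tmul, hu, hv]
      | tmul h c => simp [smashComul_tmul, WA.comul_mul]

theorem assoc_shuffleMul_shuffleMul (T : (A ⊗[k] A) ⊗[k] A) (P : H ⊗[k] (A ⊗[k] A))
    (Q : H ⊗[k] A) (r : H) :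
    TensorProduct.assoc k (A ⊗[k] H) (A ⊗[k] H) (A ⊗[k] H)
      (LinearMap.rTensor (A ⊗[k] H) (shuffleMul k A A H H)
        (shuffleMul k (A ⊗[k] A) A ((H ⊗[k] A) ⊗[k] H) H
          (T ⊗ₜ (LinearMap.lTensor ((H ⊗[k] A) ⊗[k] H) (LinearMap.mul' k A)
            (TensorProduct.tensorTensorTensorComm k (H ⊗[k] A) A H A
              ((TensorProduct.assoc k H A A).symm P ⊗ₜ Q)) ⊗ₜ r)))) =
      LinearMap.lTensor (A ⊗[k] H) (shuffleMul k A A H H)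
        (shuffleMul k A (A ⊗[k] A) H ((H ⊗[k] A) ⊗[k] H)
          (TensorProduct.assoc k A A A T ⊗ₜ (P ⊗ₜ (Q ⊗ₜ r)))) := by
  induction T with
  | zero => simp
  | add a b ha hb => simp only [map_add, TensorProduct.add_tmul, ha, hb]
  | tmul T c =>
  induction T with
  | zero => simp
  | add a b ha hb => simp only [map_add, TensorProduct.add_tmul, ha, hb]
  | tmul a b =>
  induction P with
  | zero => simp
  | add a b ha hb =>
    simp only [map_add, TensorProduct.add_tmul, TensorProduct.tmul_add, ha, hb]
  | tmul p P =>
  induction P with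
  | zero => simp
  | add a b ha hb =>
    simp only [map_add, TensorProduct.add_tmul, TensorProduct.tmul_add, ha, hb]
  | tmul d e =>
  induction Q with
  | zero => simp
  | add a b ha hb =>
    simp only [map_add, TensorProduct.add_tmul, TensorProduct.tmul_add, ha, hb]
  | tmul q f => simp [mul_assoc]

namespace IsComoduleCoalgebra

variable {WH : WeakBialgebra k H} {WA : WeakBialgebra k A} {coact : H →ₗ[k] H ⊗[k] A}

theorem rTensor_coact_comul_coact (hCC : IsComoduleCoalgebra k WH WA coact) (h : H) :
    LinearMap.rTensor A (LinearMap.rTensor H coact ∘ₗ WH.comul) (coact h) =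
      LinearMap.lTensor ((H ⊗[k] A) ⊗[k] H) (LinearMap.mul' k A)
        (TensorProduct.tensorTensorTensorComm k (H ⊗[k] A) A H A
          (TensorProduct.map ((TensorProduct.assoc k H A A).symm.toLinearMap ∘ₗ
            LinearMap.lTensor H WA.comul ∘ₗ coact) coact (WH.comul h))) := by
  have h1 : ∀ P Q : H ⊗[k] A,
      LinearMap.rTensor A (LinearMap.rTensor H coact)
        (LinearMap.lTensor (H ⊗[k] H) (LinearMap.mul' k A)
          (TensorProduct.tensorTensorTensorComm k H A H A (P ⊗ₜ Q))) =
      LinearMap.lTensor ((H ⊗[k] A) ⊗[k] H) (LinearMap.mul' k A)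
        (TensorProduct.tensorTensorTensorComm k (H ⊗[k] A) A H A
          (LinearMap.rTensor A coact P ⊗ₜ Q)) := by
    intro P Q
    induction P with
    | zero => simp
    | add a b ha hb => simp only [map_add, TensorProduct.add_tmul, ha, hb]
    | tmul p a =>
      induction Q with
      | zero => simp
      | add a b ha hb => simp only [map_add, TensorProduct.tmul_add, ha, hb]
      | tmul q b => simp
  rw [LinearMap.rTensor_comp, LinearMap.comp_apply, hCC.comul_coact]
  induction WH.comul h with
  | zero => simp
  | add a b ha hb => simp only [map_add, ha, hb]
  | tmul p q => simp [h1, ← hCC.coact_coact]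

theorem smashComul_coassoc (hCC : IsComoduleCoalgebra k WH WA coact) (c : A ⊗[k] H) :
    TensorProduct.assoc k (A ⊗[k] H) (A ⊗[k] H) (A ⊗[k] H)
        (LinearMap.rTensor (A ⊗[k] H) (smashComul k WH WA coact)
          (smashComul k WH WA coact c)) =
      LinearMap.lTensor (A ⊗[k] H) (smashComul k WH WA coact)
        (smashComul k WH WA coact c) := by
  induction c with
  | zero => simp
  | add a b ha hb => simp only [map_add, ha, hb]
  | tmul x h =>
    have h1 : LinearMap.rTensor H (LinearMap.rTensor A (LinearMap.rTensor H coact ∘ₗ WH.comul))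
          (LinearMap.rTensor H coact (WH.comul h)) =
        LinearMap.rTensor H
          (LinearMap.lTensor ((H ⊗[k] A) ⊗[k] H) (LinearMap.mul' k A) ∘ₗ
            (TensorProduct.tensorTensorTensorComm k (H ⊗[k] A) A H A).toLinearMap ∘ₗ
            TensorProduct.map ((TensorProduct.assoc k H A A).symm.toLinearMap ∘ₗ
              LinearMap.lTensor H WA.comul ∘ₗ coact) coact)
          (LinearMap.rTensor H WH.comul (WH.comul h)) := by
      induction WH.comul h with
      | zero => simp
      | add a b ha hb => simp only [map_add, ha, hb]
      | tmul p q => simp [hCC.rTensor_coact_comul_coact]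
    have h2 : TensorProduct.map (LinearMap.lTensor H WA.comul)
          (LinearMap.rTensor H coact ∘ₗ WH.comul) (LinearMap.rTensor H coact (WH.comul h)) =
        TensorProduct.map (LinearMap.lTensor H WA.comul ∘ₗ coact) (LinearMap.rTensor H coact)
          (LinearMap.lTensor H WH.comul (WH.comul h)) := by
      induction WH.comul h with
      | zero => simp
      | add a b ha hb => simp only [map_add, ha, hb]
      | tmul p q => simp
    rw [smashComul_tmul, rTensor_smashComul_shuffleMul, lTensor_smashComul_shuffleMul, h1, h2,
      ← WH.coassoc, ← WA.coassoc]
    induction LinearMap.rTensor H WH.comul (WH.comul h) with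
    | zero => simp
    | add a b ha hb => simp only [map_add, TensorProduct.tmul_add, ha, hb]
    | tmul v r =>
      induction v with
      | zero => simp
      | add a b ha hb =>
        simp only [map_add, TensorProduct.tmul_add, TensorProduct.add_tmul, ha, hb]
      | tmul p q => simp [assoc_shuffleMul_shuffleMul]

end IsComoduleCoalgebra

theorem projBar_tmul (WH : WeakBialgebra k H) (WA : WeakBialgebra k A)
    (coact : H →ₗ[k] H ⊗[k] A) (x : A) (h : H) :
    projBar k WH WA coact (x ⊗ₜ h) =
      shuffleCounit A H WA.counit (WA.comul x ⊗ₜ coact h) := by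
  have h1 : ∀ (t : A ⊗[k] A) (P : H ⊗[k] A) (q : H),
      TensorProduct.rid k (A ⊗[k] H) (LinearMap.lTensor (A ⊗[k] H) (smashCounit k WH WA)
        (shuffleMul k A A H H (t ⊗ₜ (P ⊗ₜ q)))) =
      WH.counit q • shuffleCounit A H WA.counit (t ⊗ₜ P) := by
    intro t P q
    induction t with
    | zero => simp
    | add a b ha hb => simp only [map_add, TensorProduct.add_tmul, smul_add, ha, hb]
    | tmul a b =>
      induction P with
      | zero => simp
      | add a b ha hb =>
        simp only [map_add, TensorProduct.add_tmul, TensorProduct.tmul_add, smul_add, ha, hb]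
      | tmul p c => simp [smashCounit, smul_smul, mul_comm]
  have h2 : ∀ v : H ⊗[k] H,
      TensorProduct.rid k (A ⊗[k] H) (LinearMap.lTensor (A ⊗[k] H) (smashCounit k WH WA)
        (shuffleMul k A A H H (WA.comul x ⊗ₜ LinearMap.rTensor H coact v))) =
      shuffleCounit A H WA.counit (WA.comul x ⊗ₜ
        coact (TensorProduct.rid k H (LinearMap.lTensor H WH.counit v))) := by
    intro v
    induction v with
    | zero => simp
    | add a b ha hb => simp only [map_add, TensorProduct.tmul_add, ha, hb]
    | tmul p q => simp [h1]
  have h3 : projBar k WH WA coact (x ⊗ₜ h) = TensorProduct.rid k (A ⊗[k] H)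
      (LinearMap.lTensor (A ⊗[k] H) (smashCounit k WH WA)
        (smashComul k WH WA coact (x ⊗ₜ h))) := rfl
  rw [h3, smashComul_tmul, h2, WH.comul_counit]

theorem counit_shuffleCounit (WA : WeakBialgebra k A) (t : A ⊗[k] A) (u : H ⊗[k] A) :
    shuffleCounit A H WA.counit (shuffleCounit (A ⊗[k] A) (H ⊗[k] A) WA.counit
      ((TensorProduct.assoc k A A A).symm (LinearMap.lTensor A WA.comul t) ⊗ₜ
        (TensorProduct.assoc k H A A).symm (LinearMap.lTensor H WA.comul u))) =
      shuffleCounit A H WA.counit (t ⊗ₜ u) := by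
  have h1 : ∀ (a : A) (h : H) (B C : A ⊗[k] A),
      shuffleCounit A H WA.counit (shuffleCounit (A ⊗[k] A) (H ⊗[k] A) WA.counit
        ((TensorProduct.assoc k A A A).symm (a ⊗ₜ B) ⊗ₜ
          (TensorProduct.assoc k H A A).symm (h ⊗ₜ C))) =
      WA.counit (TensorProduct.lid k A (LinearMap.rTensor A WA.counit (B * C))) •
        (a ⊗ₜ[k] h) := by
    intro a h B C
    induction B with
    | zero => simp
    | add a b ha hb =>
      simp only [map_add, TensorProduct.add_tmul, TensorProduct.tmul_add, add_mul, add_smul,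
        ha, hb]
    | tmul b b' =>
      induction C with
      | zero => simp
      | add a b ha hb =>
        simp only [map_add, TensorProduct.tmul_add, mul_add, add_smul, ha, hb]
      | tmul c c' => simp [smul_smul, mul_comm]
  induction t with
  | zero => simp
  | add a b ha hb => simp only [map_add, TensorProduct.add_tmul, ha, hb]
  | tmul a b =>
    induction u with
    | zero => simp
    | add a b ha hb => simp only [map_add, TensorProduct.tmul_add, ha, hb]
    | tmul h c => simp [h1, ← WA.comul_mul, WA.counit_comul]

theorem WeakBialgebra.comul_mul_εs (W : WeakBialgebra k A) (x w : A) :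
    W.comul (x * W.εs w) = W.comul x * ((1 : A) ⊗ₜ W.εs w) := by
  have h0 : ∀ D : A ⊗[k] A, ∀ v, v = LinearMap.lTensor A (W.counit ∘ₗ LinearMap.mulLeft k w) D →
      TensorProduct.rid k A v = TensorProduct.rid k A
        (LinearMap.lTensor A W.counit (((1 : A) ⊗ₜ[k] w) * D)) := by
    rintro D v rfl
    induction D with
    | zero => simp
    | add a b ha hb => simp only [map_add, mul_add, ha, hb]
    | tmul a b => simp
  have hε : W.εs w = TensorProduct.rid k A
      (LinearMap.lTensor A (W.counit ∘ₗ LinearMap.mulLeft k w) (W.comul 1)) :=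
    (h0 _ _ rfl).symm
  have h1 : ∀ D : A ⊗[k] A,
      W.comul (TensorProduct.rid k A
        (LinearMap.lTensor A (W.counit ∘ₗ LinearMap.mulLeft k w) D)) =
      LinearMap.lTensor A ((TensorProduct.rid k A).toLinearMap ∘ₗ
          LinearMap.lTensor A (W.counit ∘ₗ LinearMap.mulLeft k w))
        (TensorProduct.assoc k A A A (LinearMap.rTensor A W.comul D)) := by
    intro D
    have h2 : ∀ (v : A ⊗[k] A) (b : A),
        LinearMap.lTensor A ((TensorProduct.rid k A).toLinearMap ∘ₗ
          LinearMap.lTensor A (W.counit ∘ₗ LinearMap.mulLeft k w))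
          (TensorProduct.assoc k A A A (v ⊗ₜ b)) = W.counit (w * b) • v := by
      intro v b
      induction v with
      | zero => simp
      | add a b ha hb => simp only [map_add, TensorProduct.add_tmul, smul_add, ha, hb]
      | tmul a b => simp
    induction D with
    | zero => simp
    | add a b ha hb => simp only [map_add, ha, hb]
    | tmul a b => simp [h2]
  have h3 : ∀ D E : A ⊗[k] A,
      LinearMap.lTensor A ((TensorProduct.rid k A).toLinearMap ∘ₗ
          LinearMap.lTensor A (W.counit ∘ₗ LinearMap.mulLeft k w))
        (TensorProduct.assoc k A A A (D ⊗ₜ[k] (1 : A)) * ((1 : A) ⊗ₜ[k] E)) =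
      D * ((1 : A) ⊗ₜ[k] TensorProduct.rid k A
        (LinearMap.lTensor A (W.counit ∘ₗ LinearMap.mulLeft k w) E)) := by
    intro D E
    induction D with
    | zero => simp
    | add a b ha hb => simp only [map_add, TensorProduct.add_tmul, add_mul, ha, hb]
    | tmul a b =>
      induction E with
      | zero => simp
      | add a b ha hb => simp only [map_add, TensorProduct.tmul_add, mul_add, ha, hb]
      | tmul c d => simp
  rw [W.comul_mul, hε, h1, W.coassoc, ← W.comul_one_left, h3, ← mul_assoc, ← W.comul_mul,
    mul_one]

namespace IsComoduleCoalgebra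

variable {WH : WeakBialgebra k H} {WA : WeakBialgebra k A} {coact : H →ₗ[k] H ⊗[k] A}

theorem projBar_projBar (hCC : IsComoduleCoalgebra k WH WA coact) (c : A ⊗[k] H) :
    projBar k WH WA coact (projBar k WH WA coact c) = projBar k WH WA coact c := by
  have h1 : ∀ (t : A ⊗[k] A) (u : H ⊗[k] A),
      projBar k WH WA coact (shuffleCounit A H WA.counit (t ⊗ₜ u)) =
      shuffleCounit A H WA.counit (shuffleCounit (A ⊗[k] A) (H ⊗[k] A) WA.counit
        (LinearMap.rTensor A WA.comul t ⊗ₜ LinearMap.rTensor A coact u)) := by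
    intro t u
    induction t with
    | zero => simp
    | add a b ha hb => simp only [map_add, TensorProduct.add_tmul, ha, hb]
    | tmul a b =>
      induction u with
      | zero => simp
      | add a b ha hb => simp only [map_add, TensorProduct.tmul_add, ha, hb]
      | tmul h c => simp [projBar_tmul]
  induction c with
  | zero => simp
  | add a b ha hb => simp only [map_add, ha, hb]
  | tmul x h =>
    rw [projBar_tmul, h1, ← counit_shuffleCounit, ← WA.coassoc, ← hCC.coact_coact,
      LinearEquiv.symm_apply_apply, LinearEquiv.symm_apply_apply]

end IsComoduleCoalgebra

/-- The map `(ε ⊗ id) Δ` on the smash coproduct. -/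
def projBarLeft (WH : WeakBialgebra k H) (WA : WeakBialgebra k A)
    (coact : H →ₗ[k] H ⊗[k] A) : A ⊗[k] H →ₗ[k] A ⊗[k] H :=
  (TensorProduct.lid k (A ⊗[k] H)).toLinearMap ∘ₗ
    LinearMap.rTensor (A ⊗[k] H) (smashCounit k WH WA) ∘ₗ smashComul k WH WA coact

theorem projBarLeft_tmul (WH : WeakBialgebra k H) (WA : WeakBialgebra k A)
    (coact : H →ₗ[k] H ⊗[k] A) (x : A) (h : H) :
    projBarLeft WH WA coact (x ⊗ₜ h) =
      LinearMap.rTensor H (LinearMap.mulLeft k x ∘ₗ coactCounit k WH coact) (WH.comul h) := by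
  have h1 : ∀ (t : A ⊗[k] A) (P : H ⊗[k] A) (q : H),
      TensorProduct.lid k (A ⊗[k] H) (LinearMap.rTensor (A ⊗[k] H) (smashCounit k WH WA)
        (shuffleMul k A A H H (t ⊗ₜ (P ⊗ₜ q)))) =
      (TensorProduct.lid k A (LinearMap.rTensor A WA.counit t) *
        TensorProduct.lid k A (LinearMap.rTensor A WH.counit P)) ⊗ₜ q := by
    intro t P q
    induction t with
    | zero => simp
    | add a b ha hb => simp only [map_add, TensorProduct.add_tmul, add_mul, ha, hb]
    | tmul a b =>
      induction P with
      | zero => simp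
      | add a b ha hb =>
        simp only [map_add, TensorProduct.add_tmul, TensorProduct.tmul_add, mul_add, ha, hb]
      | tmul p c => simp [smashCounit, smul_smul, TensorProduct.smul_tmul', mul_comm]
  have h2 : projBarLeft WH WA coact (x ⊗ₜ h) = TensorProduct.lid k (A ⊗[k] H)
      (LinearMap.rTensor (A ⊗[k] H) (smashCounit k WH WA)
        (smashComul k WH WA coact (x ⊗ₜ h))) := rfl
  rw [h2, smashComul_tmul]
  induction WH.comul h with
  | zero => simp
  | add a b ha hb => simp only [map_add, TensorProduct.tmul_add, ha, hb]
  | tmul p q =>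
    rw [LinearMap.rTensor_tmul, h1, WA.counit_comul]
    rfl

theorem IsComoduleCoalgebra.projBar_comp_projBarLeft {WH : WeakBialgebra k H}
    {WA : WeakBialgebra k A} {coact : H →ₗ[k] H ⊗[k] A}
    (hCC : IsComoduleCoalgebra k WH WA coact) :
    projBar k WH WA coact ∘ₗ projBarLeft WH WA coact = projBar k WH WA coact := by
  ext x h
  have h1 : ∀ (z : A) (t : A ⊗[k] A) (Q : H ⊗[k] A),
      shuffleCounit A H WA.counit ((t * ((1 : A) ⊗ₜ z)) ⊗ₜ Q) =
        shuffleCounit A H WA.counit (t ⊗ₜ LinearMap.lTensor H (LinearMap.mulLeft k z) Q) := by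
    intro z t Q
    induction t with
    | zero => simp
    | add a b ha hb => simp only [map_add, TensorProduct.add_tmul, add_mul, ha, hb]
    | tmul a b =>
      induction Q with
      | zero => simp
      | add a b ha hb => simp only [map_add, TensorProduct.tmul_add, ha, hb]
      | tmul q c => simp [mul_assoc]
  have hadd : ∀ a b : A, LinearMap.mulLeft k (a + b) =
      LinearMap.mulLeft k a + LinearMap.mulLeft k b := by
    intro a b
    ext c
    simp [add_mul]
  have h2 : ∀ P Q : H ⊗[k] A,
      LinearMap.rTensor A ((TensorProduct.lid k H).toLinearMap ∘ₗ LinearMap.rTensor H WH.counit)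
        (LinearMap.lTensor (H ⊗[k] H) (LinearMap.mul' k A)
          (TensorProduct.tensorTensorTensorComm k H A H A (P ⊗ₜ Q))) =
      LinearMap.lTensor H (LinearMap.mulLeft k
        (TensorProduct.lid k A (LinearMap.rTensor A WH.counit P))) Q := by
    intro P Q
    induction P with
    | zero => simp
    | add a b ha hb =>
      simp only [map_add, TensorProduct.add_tmul, hadd, LinearMap.lTensor_add,
        LinearMap.add_apply, ha, hb]
    | tmul p a =>
      induction Q with
      | zero => simp
      | add a b ha hb => simp only [map_add, TensorProduct.tmul_add, ha, hb]
      | tmul q b => simp [TensorProduct.smul_tmul']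
  have h3 : ∀ v : H ⊗[k] H,
      projBar k WH WA coact
        (LinearMap.rTensor H (LinearMap.mulLeft k x ∘ₗ coactCounit k WH coact) v) =
      shuffleCounit A H WA.counit (WA.comul x ⊗ₜ
        LinearMap.rTensor A
          ((TensorProduct.lid k H).toLinearMap ∘ₗ LinearMap.rTensor H WH.counit)
          (LinearMap.lTensor (H ⊗[k] H) (LinearMap.mul' k A)
            (TensorProduct.tensorTensorTensorComm k H A H A
              (TensorProduct.map coact coact v)))) := by
    intro v
    induction v with
    | zero => simp
    | add a b ha hb => simp only [map_add, TensorProduct.tmul_add, ha, hb]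
    | tmul p q =>
      rw [LinearMap.rTensor_tmul, projBar_tmul, LinearMap.comp_apply, LinearMap.mulLeft_apply,
        hCC.coact_counit, WA.comul_mul_εs, ← hCC.coact_counit, h1, TensorProduct.map_tmul, h2]
      rfl
  have h4 : LinearMap.rTensor A
        ((TensorProduct.lid k H).toLinearMap ∘ₗ LinearMap.rTensor H WH.counit)
        (LinearMap.rTensor A WH.comul (coact h)) = coact h := by
    rw [← LinearMap.comp_apply, ← LinearMap.rTensor_comp]
    convert LinearMap.id_apply (R := k) (coact h)
    rw [← LinearMap.rTensor_id]
    congr 1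
    ext g
    exact WH.counit_comul g
  rw [hCC.comul_coact] at h4
  simp only [TensorProduct.AlgebraTensorModule.curry_apply, LinearMap.restrictScalars_self,
    TensorProduct.curry_apply, LinearMap.comp_apply]
  rw [projBarLeft_tmul, h3, projBar_tmul]
  exact congrArg (fun u => shuffleCounit A H WA.counit (WA.comul x ⊗ₜ u)) h4

end SmashCoproduct

theorem bar_coalgebra
    {k H A : Type*} [Field k] [Ring H] [Algebra k H] [Ring A] [Algebra k A]
    (WH : WeakBialgebra k H) (WA : WeakBialgebra k A)
    (coact : H →ₗ[k] H ⊗[k] A) (hCC : IsComoduleCoalgebra k WH WA coact) :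
    (∀ (x : A) (h : H),
        smashComul k WH WA coact (projBar k WH WA coact (x ⊗ₜ[k] h)) =
          (TensorProduct.map (projBar k WH WA coact) (projBar k WH WA coact))
            (smashComul k WH WA coact (x ⊗ₜ[k] h))) ∧
    (∀ (x : A) (h : H),
        smashComul k WH WA coact (projBar k WH WA coact (x ⊗ₜ[k] h)) ∈
          LinearMap.range
            (TensorProduct.map (projBar k WH WA coact) (projBar k WH WA coact))) ∧
    (∀ (x : A) (h : H),
        (TensorProduct.lid k (A ⊗[k] H))
            ((LinearMap.rTensor (A ⊗[k] H) (smashCounit k WH WA))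
              (smashComul k WH WA coact (projBar k WH WA coact (x ⊗ₜ[k] h)))) =
          projBar k WH WA coact (x ⊗ₜ[k] h)) ∧
    (∀ (x : A) (h : H),
        (TensorProduct.rid k (A ⊗[k] H))
            ((LinearMap.lTensor (A ⊗[k] H) (smashCounit k WH WA))
              (smashComul k WH WA coact (projBar k WH WA coact (x ⊗ₜ[k] h)))) =
          projBar k WH WA coact (x ⊗ₜ[k] h)) := by
  have hΔ := hCC.smashComul_coassoc
  have hq : ∀ c, projBarLeft WH WA coact c = TensorProduct.lid k (A ⊗[k] H)
      (LinearMap.rTensor (A ⊗[k] H) (smashCounit k WH WA) (smashComul k WH WA coact c)) :=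
    fun _ => rfl
  have hp : ∀ c, projBar k WH WA coact c = TensorProduct.rid k (A ⊗[k] H)
      (LinearMap.lTensor (A ⊗[k] H) (smashCounit k WH WA) (smashComul k WH WA coact c)) :=
    fun _ => rfl
  have hpq := hCC.projBar_comp_projBarLeft
  have hmap := map_rightProj_comul hΔ hp hq hpq
  refine ⟨fun x h => hmap _, fun x h => ⟨_, (hmap _).symm⟩, fun x h => ?_, fun x h => ?_⟩
  · rw [← hq, leftProj_rightProj_comm hΔ hp hq]
    exact LinearMap.congr_fun hpq _
  · rw [← hp, hCC.projBar_projBar]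

end WeakSmash
end
end
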